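/- Let m ≥ 2 and 1 ≤ r ≤ m be integers, let O be a random orthogonal matrix distributed according to the Haar probability measure on the orthogonal group O(m), let O_r consist of the first r columns of O, and set Q₀ := O_r O_rᵀ. Then E[((Q₀)_{12})²] = r(m−r)/(m(m−1)(m+2)). -/

import Mathlib

open MeasureTheory Matrix

/-- Matrices carry the product σ-algebra (entrywise). -/
instance matrixMeasurableSpace {m n : ℕ} : MeasurableSpace (Matrix (Fin m) (Fin n) ℝ) :=
  inferInstanceAs (MeasurableSpace (Fin m → Fin n → ℝ))

/-- The permutation group of a type acts transitively on pairs of distinct points. -/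
theorem exists_perm_pair {α : Type*} [DecidableEq α] {i j k l : α} (hij : i ≠ j) (hkl : k ≠ l) :
    ∃ σ : Equiv.Perm α, σ i = k ∧ σ j = l := by
  refine ⟨(Equiv.swap i k).trans (Equiv.swap (Equiv.swap i k j) l), ?_, by simp⟩
  have h : k ≠ Equiv.swap i k j := fun h => hij <| (Equiv.swap i k).injective (by simpa using h)
  simpa using Equiv.swap_apply_of_ne_of_ne h hkl

/-- A Householder reflection is orthogonal. -/
theorem householder_transpose_mul_self {n : Type*} [Fintype n] [DecidableEq n] (v : n → ℝ) (c : ℝ)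
    (hc : c * (v ⬝ᵥ v) = 2) :
    (1 - c • vecMulVec v v)ᵀ * (1 - c • vecMulVec v v) = 1 := by
  have h : vecMulVec v v * vecMulVec v v = (v ⬝ᵥ v) • vecMulVec v v := by
    rw [vecMulVec_mul_vecMulVec, vecMulVec_smul]
  rw [transpose_sub, transpose_smul, transpose_vecMulVec, transpose_one, sub_mul, one_mul, mul_sub,
    mul_one, smul_mul_smul_comm, h, smul_smul, mul_assoc, hc, mul_two, add_smul]
  simp

section InvariantProjection

variable {m : ℕ} {Ω : Type*} [MeasurableSpace Ω] {μ : Measure Ω} {Q : Ω → Matrix (Fin m) (Fin m) ℝ}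

theorem measurable_matrix_entry (i j : Fin m) :
    Measurable fun M : Matrix (Fin m) (Fin m) ℝ => M i j :=
  (measurable_pi_apply j).comp (measurable_pi_apply i)

/-- The squared Frobenius norm of an orthogonal projection is its trace. -/
theorem sum_sq_eq_trace_of_isSymm {P : Matrix (Fin m) (Fin m) ℝ} (hs : P.IsSymm)
    (hP : P * P = P) : ∑ i, ∑ j, P i j ^ 2 = P.trace := by
  conv_rhs => rw [← hP]
  refine Finset.sum_congr rfl fun i _ => ?_
  rw [diag_apply, mul_apply]
  exact Finset.sum_congr rfl fun j _ => by rw [hs.apply, sq]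

theorem integrable_entry_mul_entry [IsFiniteMeasure μ] (hQ : Measurable Q) {t : ℝ}
    (hs : ∀ᵐ ω ∂μ, (Q ω).IsSymm) (hP : ∀ᵐ ω ∂μ, Q ω * Q ω = Q ω)
    (ht : ∀ᵐ ω ∂μ, (Q ω).trace = t) (i j k l : Fin m) :
    Integrable (fun ω => Q ω i j * Q ω k l) μ := by
  have hent (i j : Fin m) : Measurable fun ω => Q ω i j := (measurable_matrix_entry i j).comp hQ
  refine Integrable.of_bound ((hent i j).mul (hent k l)).aestronglyMeasurable t ?_
  filter_upwards [hs, hP, ht] with ω h1 h2 h3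
  have hle (i j : Fin m) : Q ω i j ^ 2 ≤ t := by
    rw [← h3, ← sum_sq_eq_trace_of_isSymm h1 h2]
    calc Q ω i j ^ 2 ≤ ∑ j, Q ω i j ^ 2 :=
          Finset.single_le_sum (f := fun j => Q ω i j ^ 2) (fun _ _ => sq_nonneg _)
            (Finset.mem_univ j)
      _ ≤ _ := Finset.single_le_sum (f := fun i => ∑ j, Q ω i j ^ 2)
          (fun _ _ => Finset.sum_nonneg fun _ _ => sq_nonneg _) (Finset.mem_univ i)
  rw [Real.norm_eq_abs, abs_le]
  constructor <;>
    nlinarith [hle i j, hle k l, sq_nonneg (Q ω i j - Q ω k l), sq_nonneg (Q ω i j + Q ω k l)]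

theorem integral_conj_eq (hQ : Measurable Q) {g : Matrix (Fin m) (Fin m) ℝ}
    (hg : μ.map (fun ω => g * Q ω * gᵀ) = μ.map Q) {f : Matrix (Fin m) (Fin m) ℝ → ℝ}
    (hf : Measurable f) : ∫ ω, f (g * Q ω * gᵀ) ∂μ = ∫ ω, f (Q ω) ∂μ := by
  have hent (i j : Fin m) : Measurable fun ω => Q ω i j := (measurable_matrix_entry i j).comp hQ
  have hc : Measurable fun ω => g * Q ω * gᵀ := by
    refine measurable_pi_iff.2 fun i => measurable_pi_iff.2 fun j => ?_
    simp only [mul_apply]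
    fun_prop
  rw [← integral_map hc.aemeasurable hf.aestronglyMeasurable, hg,
    integral_map hQ.aemeasurable hf.aestronglyMeasurable]

theorem integral_perm_eq (hQ : Measurable Q)
    (hinv : ∀ g : Matrix (Fin m) (Fin m) ℝ, gᵀ * g = 1 →
      μ.map (fun ω => g * Q ω * gᵀ) = μ.map Q) (σ : Equiv.Perm (Fin m)) (i j k l : Fin m) :
    ∫ ω, Q ω (σ i) (σ j) * Q ω (σ k) (σ l) ∂μ = ∫ ω, Q ω i j * Q ω k l ∂μ := by
  have hg : (σ.toPEquiv.toMatrix : Matrix (Fin m) (Fin m) ℝ)ᵀ * σ.toPEquiv.toMatrix = 1 := by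
    rw [← PEquiv.toMatrix_symm, ← Equiv.toPEquiv_symm, PEquiv.toMatrix_toPEquiv_mul]
    ext i j
    simp [PEquiv.toMatrix_apply, one_apply]
  have hconj (M : Matrix (Fin m) (Fin m) ℝ) (i j : Fin m) :
      ((σ.toPEquiv.toMatrix : Matrix (Fin m) (Fin m) ℝ) * M *
        (σ.toPEquiv.toMatrix : Matrix (Fin m) (Fin m) ℝ)ᵀ) i j =
        M (σ i) (σ j) := by
    rw [← PEquiv.toMatrix_symm, ← Equiv.toPEquiv_symm, PEquiv.toMatrix_toPEquiv_mul,
      PEquiv.mul_toMatrix_toPEquiv]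
    simp
  simpa only [Pi.mul_apply, hconj] using integral_conj_eq hQ (hinv _ hg)
    ((measurable_matrix_entry i j).mul (measurable_matrix_entry k l))

/-- Reflecting in the plane of the coordinates `p` and `q` relates the second moment of the
`(p, q)` entry to those of the diagonal entries. -/
theorem two_mul_integral_sq_entry [IsFiniteMeasure μ] (hQ : Measurable Q) {t : ℝ}
    (hs : ∀ᵐ ω ∂μ, (Q ω).IsSymm) (hP : ∀ᵐ ω ∂μ, Q ω * Q ω = Q ω)
    (ht : ∀ᵐ ω ∂μ, (Q ω).trace = t)
    (hinv : ∀ g : Matrix (Fin m) (Fin m) ℝ, gᵀ * g = 1 →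
      μ.map (fun ω => g * Q ω * gᵀ) = μ.map Q) {p q : Fin m} (hpq : p ≠ q) :
    2 * ∫ ω, Q ω p q * Q ω p q ∂μ =
      ∫ ω, Q ω p p * Q ω p p ∂μ - ∫ ω, Q ω p p * Q ω q q ∂μ := by
  have hI := integrable_entry_mul_entry hQ hs hP ht
  set v : Fin m → ℝ := Pi.single p 1 + Pi.single q 2 with hv
  have hvp : v p = 1 := by simp [hv, hpq]
  have hvq : v q = 2 := by simp [hv, hpq.symm]
  have hdot (w : Fin m → ℝ) : v ⬝ᵥ w = w p + 2 * w q := by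
    simp [hv, add_dotProduct]
  have hdot' (w : Fin m → ℝ) : w ⬝ᵥ v = w p + 2 * w q := by rw [dotProduct_comm, hdot]
  set g : Matrix (Fin m) (Fin m) ℝ := 1 - (2 / 5 : ℝ) • vecMulVec v v with hg
  have hgo : gᵀ * g = 1 := householder_transpose_mul_self v _ (by rw [hdot, hvp, hvq]; norm_num)
  have hgt : gᵀ = g := by simp [hg, transpose_vecMulVec]
  have hent (M : Matrix (Fin m) (Fin m) ℝ) : (g * M * gᵀ) p q =
      12 / 25 * (M q q - M p p) + 16 / 25 * M q p - 9 / 25 * M p q := by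
    rw [hgt, hg]
    simp only [sub_mul, mul_sub, one_mul, mul_one, smul_mul_assoc, mul_smul_comm,
      vecMulVec_mul, mul_vecMulVec, Matrix.sub_apply, Matrix.smul_apply, vecMulVec_apply, vecMul,
      mulVec,
      hdot, hdot', hvp, hvq, smul_eq_mul]
    ring
  have h1 := integral_conj_eq hQ (hinv g hgo)
    ((measurable_matrix_entry p q).mul (measurable_matrix_entry p q))
  have h2 : ∫ ω, (g * Q ω * gᵀ) p q * (g * Q ω * gᵀ) p q ∂μ =
      144 / 625 * ∫ ω, Q ω q q * Q ω q q ∂μ + 144 / 625 * ∫ ω, Q ω p p * Q ω p p ∂μ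
      - 288 / 625 * ∫ ω, Q ω p p * Q ω q q ∂μ + 49 / 625 * ∫ ω, Q ω p q * Q ω p q ∂μ
      + 168 / 625 * ∫ ω, Q ω q q * Q ω q p ∂μ - 168 / 625 * ∫ ω, Q ω p p * Q ω p q ∂μ := by
    simp only [← integral_const_mul]
    rw [← integral_add, ← integral_sub, ← integral_add, ← integral_add, ← integral_sub]
    · refine integral_congr_ae ?_
      filter_upwards [hs] with ω h
      rw [hent, h.apply p q]
      ring
    all_goals fun_prop
  have hsq := integral_perm_eq hQ hinv (Equiv.swap p q)
  have h3 := hsq p p p p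
  have h4 := hsq p p p q
  simp only [Equiv.swap_apply_left, Equiv.swap_apply_right] at h3 h4
  simp only [Pi.mul_apply] at h1
  rw [h2, h3, h4] at h1
  linarith

/-- The second moment of an off-diagonal entry of a random orthogonal projection of rank `t` whose
law is invariant under orthogonal conjugation. -/
theorem integral_sq_entry_of_conj_invariant [IsProbabilityMeasure μ] (hQ : Measurable Q) {t : ℝ}
    (hs : ∀ᵐ ω ∂μ, (Q ω).IsSymm) (hP : ∀ᵐ ω ∂μ, Q ω * Q ω = Q ω)
    (ht : ∀ᵐ ω ∂μ, (Q ω).trace = t)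
    (hinv : ∀ g : Matrix (Fin m) (Fin m) ℝ, gᵀ * g = 1 →
      μ.map (fun ω => g * Q ω * gᵀ) = μ.map Q) {p q : Fin m} (hpq : p ≠ q) :
    ∫ ω, Q ω p q ^ 2 ∂μ = t * (m - t) / (m * (m - 1) * (m + 2)) := by
  have hI := integrable_entry_mul_entry hQ hs hP ht
  have hrot := two_mul_integral_sq_entry hQ hs hP ht hinv hpq
  set a := ∫ ω, Q ω p p * Q ω p p ∂μ
  set b := ∫ ω, Q ω p p * Q ω q q ∂μ with hb
  simp only [sq]
  set c := ∫ ω, Q ω p q * Q ω p q ∂μ with hc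
  have ha' (i : Fin m) : ∫ ω, Q ω i i * Q ω i i ∂μ = a := by
    simpa using integral_perm_eq hQ hinv (Equiv.swap p i) p p p p
  have hb' (i j : Fin m) (hij : i ≠ j) : ∫ ω, Q ω i i * Q ω j j ∂μ = b := by
    obtain ⟨σ, rfl, rfl⟩ := exists_perm_pair hpq hij
    exact integral_perm_eq hQ hinv σ p p q q
  have hc' (i j : Fin m) (hij : i ≠ j) : ∫ ω, Q ω i j * Q ω i j ∂μ = c := by
    obtain ⟨σ, rfl, rfl⟩ := exists_perm_pair hpq hij
    exact integral_perm_eq hQ hinv σ p q p q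
  have hsum (x y : ℝ) : ∑ i : Fin m, ∑ j : Fin m, (if i = j then x else y) =
      m * x + m * (m - 1) * y := by
    have h (i j : Fin m) : (if i = j then x else y) = (if i = j then x - y else 0) + y := by
      split_ifs <;> ring
    simp only [h, Finset.sum_add_distrib, Finset.sum_ite_eq, Finset.mem_univ, if_true,
      Finset.sum_const, Finset.card_univ, Fintype.card_fin, nsmul_eq_mul]
    ring
  have htr : m * a + m * (m - 1) * b = t * t := by
    have h : ∫ ω, ∑ i, ∑ j, Q ω i i * Q ω j j ∂μ = t * t := by
      rw [integral_congr_ae (g := fun _ => t * t)]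
      · simp
      · filter_upwards [ht] with ω h
        rw [← Finset.sum_mul_sum, ← h]
        rfl
    rw [← h, ← hsum, integral_finsetSum _ fun i _ => integrable_finsetSum _ fun j _ => hI _ _ _ _]
    refine Finset.sum_congr rfl fun i _ => ?_
    rw [integral_finsetSum _ fun j _ => hI _ _ _ _]
    refine Finset.sum_congr rfl fun j _ => ?_
    split_ifs with hij
    · rw [← hij, ha']
    · rw [hb' i j hij]
  have hfr : m * a + m * (m - 1) * c = t := by
    have h : ∫ ω, ∑ i, ∑ j, Q ω i j * Q ω i j ∂μ = t := by
      rw [integral_congr_ae (g := fun _ => t)]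
      · simp
      · filter_upwards [hs, hP, ht] with ω h1 h2 h3
        simp only [← h3, ← sum_sq_eq_trace_of_isSymm h1 h2, sq]
    rw [← h, ← hsum, integral_finsetSum _ fun i _ => integrable_finsetSum _ fun j _ => hI _ _ _ _]
    refine Finset.sum_congr rfl fun i _ => ?_
    rw [integral_finsetSum _ fun j _ => hI _ _ _ _]
    refine Finset.sum_congr rfl fun j _ => ?_
    split_ifs with hij
    · rw [← hij, ha']
    · rw [hc' i j hij]
  have hm : (2 : ℝ) ≤ m := by
    have : 2 ≤ m := by have := p.2; have := q.2; have := Fin.val_ne_of_ne hpq; omega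
    exact_mod_cast this
  have h0 : (m : ℝ) * (m - 1) * (m + 2) ≠ 0 := by
    have : (m : ℝ) - 1 > 0 := by linarith
    positivity
  rw [eq_div_iff h0]
  linear_combination (m : ℝ) * hfr - htr + (m : ℝ) * (m - 1) * hrot

end InvariantProjection

/-- Let `m ≥ 2`, `1 ≤ r ≤ m`, let `O` be Haar-distributed on `O(m)`,
let `O_r` be its first `r` columns, and `Q₀ := O_r O_rᵀ`. Then
`E[((Q₀)_{12})²] = r(m−r)/(m(m−1)(m+2))`. -/
theorem stmt5
    (m r : ℕ) (hm : 2 ≤ m) (hr : 1 ≤ r) (hrm : r ≤ m)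
    {Ω : Type} [MeasurableSpace Ω] (μ : Measure Ω) [IsProbabilityMeasure μ]
    (O : Ω → Matrix (Fin m) (Fin m) ℝ) (hOmeas : Measurable O)
    (hOorth : ∀ᵐ ω ∂μ, (O ω)ᵀ * O ω = 1)
    (hOhaar : ∀ g : Matrix (Fin m) (Fin m) ℝ, gᵀ * g = 1 →
      Measure.map (fun ω => g * O ω) μ = Measure.map O μ)
    (Q₀ : Ω → Matrix (Fin m) (Fin m) ℝ)
    (hQ₀ : ∀ ω, Q₀ ω =
      (O ω).submatrix id (Fin.castLE hrm) * ((O ω).submatrix id (Fin.castLE hrm))ᵀ) :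
    ∫ ω, (Q₀ ω (⟨0, by omega⟩ : Fin m) (⟨1, by omega⟩ : Fin m)) ^ 2 ∂μ =
      (r : ℝ) * ((m : ℝ) - (r : ℝ)) / ((m : ℝ) * ((m : ℝ) - 1) * ((m : ℝ) + 2)) := by
  set A : Matrix (Fin m) (Fin m) ℝ → Matrix (Fin m) (Fin r) ℝ :=
    fun M => M.submatrix id (Fin.castLE hrm) with hA
  have hQ₀' : Q₀ = (fun M => A M * (A M)ᵀ) ∘ O := funext hQ₀
  have hAm : Measurable fun M => A M * (A M)ᵀ := by
    have hent := measurable_matrix_entry (m := m)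
    refine measurable_pi_iff.2 fun i => measurable_pi_iff.2 fun j => ?_
    simp only [mul_apply, hA, transpose_apply, submatrix_apply]
    fun_prop
  have hAO : ∀ᵐ ω ∂μ, (A (O ω))ᵀ * A (O ω) = 1 := by
    filter_upwards [hOorth] with ω h
    rw [hA, transpose_submatrix, ← submatrix_mul _ _ _ _ _ Function.bijective_id, h]
    exact submatrix_one _ (Fin.castLE_injective hrm)
  refine integral_sq_entry_of_conj_invariant (hQ₀' ▸ hAm.comp hOmeas) ?_ ?_ ?_ ?_ (by simp)
  · exact .of_forall fun ω => by
      rw [hQ₀, IsSymm, transpose_mul, transpose_transpose]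
  · filter_upwards [hAO] with ω h
    rw [hQ₀, Matrix.mul_assoc, ← Matrix.mul_assoc _ (A (O ω)), h, Matrix.one_mul]
  · filter_upwards [hAO] with ω h
    rw [hQ₀, trace_mul_comm, h, trace_one, Fintype.card_fin]
  · intro g hg
    have hgm : Measurable fun ω => g * O ω := by
      have hent (i j : Fin m) : Measurable fun ω => O ω i j :=
        (measurable_matrix_entry i j).comp hOmeas
      refine measurable_pi_iff.2 fun i => measurable_pi_iff.2 fun j => ?_
      simp only [mul_apply]
      fun_prop
    have hconj : (fun ω => g * Q₀ ω * gᵀ) = (fun M => A M * (A M)ᵀ) ∘ fun ω => g * O ω := by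
      funext ω
      have h : A (g * O ω) = g * A (O ω) := rfl
      simp only [hQ₀', Function.comp_apply, h, transpose_mul, Matrix.mul_assoc]
    rw [hconj, ← Measure.map_map hAm hgm, hOhaar g hg, Measure.map_map hAm hOmeas, hQ₀']
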